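/- (Flat-model tangentiality of the GJMS operator Δ^k; flat case of the Graham–Jenne–Mason–Sparling proposition quoted in the paper.) Let k ≥ 1 be an integer and let g be a smooth function on ℝ^N ∖ {0} homogeneous of weight k − 2 − n/2. Then Δ^k(Q · g) = Q · Δ^k g on ℝ^N ∖ {0}. Consequently, if f is homogeneous of weight k − n/2, then the restriction of Δ^k f to the null cone {Q = 0} depends only on the restriction of f to the null cone. -/

import Mathlib

open scoped BigOperators

/-- Partial derivative in the `A`-th coordinate direction. -/
noncomputable def pd {N : ℕ} (A : Fin N) (f : (Fin N → ℝ) → ℝ) : (Fin N → ℝ) → ℝ :=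
  fun x => fderiv ℝ f x (Pi.single A 1)

/-- Ambient Laplacian `Δf = ∑_{A,B} h^{AB} ∂_A ∂_B f` w.r.t. the inverse metric `hInv`. -/
noncomputable def lap {N : ℕ} (hInv : Matrix (Fin N) (Fin N) ℝ)
    (f : (Fin N → ℝ) → ℝ) : (Fin N → ℝ) → ℝ :=
  fun x => ∑ A : Fin N, ∑ B : Fin N, hInv A B * pd A (pd B f) x

/-- `X_A(x) = ∑_B h_{AB} x^B`. -/
def Xc {N : ℕ} (h : Matrix (Fin N) (Fin N) ℝ) (A : Fin N) : (Fin N → ℝ) → ℝ :=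
  fun x => ∑ B : Fin N, h A B * x B

/-- `Q(x) = ∑_{A,B} h_{AB} x^A x^B`. -/
def Qfun {N : ℕ} (h : Matrix (Fin N) (Fin N) ℝ) : (Fin N → ℝ) → ℝ :=
  fun x => ∑ A : Fin N, ∑ B : Fin N, h A B * x A * x B

/-- Smooth (C^∞) on `ℝ^N ∖ {0}`. -/
def SmoothOffZero {N : ℕ} (f : (Fin N → ℝ) → ℝ) : Prop :=
  ContDiffOn ℝ (⊤ : ℕ∞) f {x : Fin N → ℝ | x ≠ 0}

/-- Homogeneous of weight `w` on `ℝ^N ∖ {0}`. -/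
def Homog {N : ℕ} (w : ℝ) (f : (Fin N → ℝ) → ℝ) : Prop :=
  ∀ x : Fin N → ℝ, x ≠ 0 → (∑ A : Fin N, x A * pd A f x) = w * f x

/-- Ambient tractor-D operator at weight `w`: `(D^{(w)} f)_A = (n+2w−2)∂_A f − X_A Δf`. -/
noncomputable def Dop {N : ℕ} (n : ℕ) (h hInv : Matrix (Fin N) (Fin N) ℝ) (w : ℝ)
    (f : (Fin N → ℝ) → ℝ) (A : Fin N) : (Fin N → ℝ) → ℝ :=
  fun x => ((n : ℝ) + 2 * w - 2) * pd A f x - Xc h A x * lap hInv f x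

/-- Iterated tractor-D: `seqD … w0 f A 0 = f` and
`seqD … w0 f A (j+1) = (D^{(w0−j)} (seqD … w0 f A j))_{A (j+1)}`. -/
noncomputable def seqD {N : ℕ} (n : ℕ) (h hInv : Matrix (Fin N) (Fin N) ℝ)
    (w0 : ℝ) (f : (Fin N → ℝ) → ℝ) (A : ℕ → Fin N) : ℕ → (Fin N → ℝ) → ℝ
  | 0 => f
  | j + 1 => Dop n h hInv (w0 - (j : ℝ)) (seqD n h hInv w0 f A j) (A (j + 1))

/-- `u` is `O(Q^m)`: `u = Q^m · g` for some smooth `g` on `ℝ^N ∖ {0}`. -/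
def BigOQ {N : ℕ} (h : Matrix (Fin N) (Fin N) ℝ) (m : ℕ) (u : (Fin N → ℝ) → ℝ) : Prop :=
  ∃ g : (Fin N → ℝ) → ℝ, SmoothOffZero g ∧
    ∀ x : Fin N → ℝ, x ≠ 0 → u x = (Qfun h x) ^ m * g x

section PartialDerivatives

variable {N : ℕ} {f g : (Fin N → ℝ) → ℝ} {x : Fin N → ℝ}

lemma isOpen_offZero : IsOpen {x : Fin N → ℝ | x ≠ 0} := isOpen_ne

lemma SmoothOffZero.contDiffAt (hf : SmoothOffZero f) (hx : x ≠ 0) :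
    ContDiffAt ℝ (⊤ : ℕ∞) f x :=
  ContDiffOn.contDiffAt hf (isOpen_offZero.mem_nhds hx)

lemma SmoothOffZero.differentiableAt (hf : SmoothOffZero f) (hx : x ≠ 0) :
    DifferentiableAt ℝ f x :=
  (hf.contDiffAt hx).differentiableAt (by simp)

lemma SmoothOffZero.sub (hf : SmoothOffZero f) (hg : SmoothOffZero g) :
    SmoothOffZero (fun y => f y - g y) := ContDiffOn.sub hf hg

lemma SmoothOffZero.mul (hf : SmoothOffZero f) (hg : SmoothOffZero g) :
    SmoothOffZero (fun y => f y * g y) := ContDiffOn.mul hf hg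

lemma SmoothOffZero.const_mul (c : ℝ) (hf : SmoothOffZero f) :
    SmoothOffZero (fun y => c * f y) := ContDiffOn.mul contDiffOn_const hf

lemma SmoothOffZero.sum {ι : Type*} {s : Finset ι} {F : ι → (Fin N → ℝ) → ℝ}
    (hF : ∀ i ∈ s, SmoothOffZero (F i)) : SmoothOffZero (fun y => ∑ i ∈ s, F i y) :=
  ContDiffOn.sum hF

lemma smoothOffZero_coord (A : Fin N) : SmoothOffZero (fun y => y A) :=
  (contDiff_apply ℝ ℝ A).contDiffOn

lemma SmoothOffZero.pd (hf : SmoothOffZero f) (A : Fin N) : SmoothOffZero (pd A f) := by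
  have h1 : ContDiffOn ℝ (⊤ : ℕ∞) (fderiv ℝ f) {x : Fin N → ℝ | x ≠ 0} :=
    ContDiffOn.fderiv_of_isOpen hf isOpen_offZero (by simp)
  exact h1.clm_apply contDiffOn_const

lemma SmoothOffZero.lap (hf : SmoothOffZero f) (hInv : Matrix (Fin N) (Fin N) ℝ) :
    SmoothOffZero (lap hInv f) :=
  SmoothOffZero.sum fun A _ => SmoothOffZero.sum fun B _ => ((hf.pd B).pd A).const_mul _

lemma SmoothOffZero.iterate_lap (hf : SmoothOffZero f) (hInv : Matrix (Fin N) (Fin N) ℝ) (k : ℕ) :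
    SmoothOffZero ((_root_.lap hInv)^[k] f) := by
  induction k with
  | zero => exact hf
  | succ k ih => rw [Function.iterate_succ_apply']; exact ih.lap hInv

lemma pd_congr (hfg : ∀ y, y ≠ 0 → f y = g y) (A : Fin N) (hx : x ≠ 0) : pd A f x = pd A g x := by
  have : f =ᶠ[nhds x] g := Filter.eventuallyEq_of_mem (isOpen_offZero.mem_nhds hx) hfg
  simp only [pd, this.fderiv_eq]

lemma lap_congr (hInv : Matrix (Fin N) (Fin N) ℝ) (hfg : ∀ y, y ≠ 0 → f y = g y) (hx : x ≠ 0) :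
    lap hInv f x = lap hInv g x := by
  simp only [lap]
  refine Finset.sum_congr rfl fun A _ => Finset.sum_congr rfl fun B _ => ?_
  rw [pd_congr (fun y hy => pd_congr hfg B hy) A hx]

lemma iterate_lap_congr (hInv : Matrix (Fin N) (Fin N) ℝ) (hfg : ∀ y, y ≠ 0 → f y = g y) (k : ℕ) :
    ∀ x, x ≠ 0 → (lap hInv)^[k] f x = (lap hInv)^[k] g x := by
  induction k with
  | zero => exact hfg
  | succ k ih =>
    intro x hx
    simp only [Function.iterate_succ_apply']
    exact lap_congr hInv ih hx

lemma pd_add (hf : SmoothOffZero f) (hg : SmoothOffZero g) (A : Fin N) (hx : x ≠ 0) :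
    pd A (fun y => f y + g y) x = pd A f x + pd A g x := by
  simp only [pd]
  rw [fderiv_fun_add (hf.differentiableAt hx) (hg.differentiableAt hx)]
  rfl

lemma pd_const_mul (c : ℝ) (hf : SmoothOffZero f) (A : Fin N) (hx : x ≠ 0) :
    pd A (fun y => c * f y) x = c * pd A f x := by
  simp only [pd]
  rw [fderiv_const_mul (hf.differentiableAt hx)]
  rfl

lemma pd_mul (hf : SmoothOffZero f) (hg : SmoothOffZero g) (A : Fin N) (hx : x ≠ 0) :
    pd A (fun y => f y * g y) x = f x * pd A g x + pd A f x * g x := by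
  simp only [pd]
  rw [fderiv_fun_mul (hf.differentiableAt hx) (hg.differentiableAt hx)]
  simp [mul_comm]

lemma pd_sum {ι : Type*} {s : Finset ι} {F : ι → (Fin N → ℝ) → ℝ}
    (hF : ∀ i ∈ s, SmoothOffZero (F i)) (A : Fin N) (hx : x ≠ 0) :
    pd A (fun y => ∑ i ∈ s, F i y) x = ∑ i ∈ s, pd A (F i) x := by
  simp only [pd]
  rw [fderiv_fun_sum fun i hi => (hF i hi).differentiableAt hx]
  simp

lemma pd_coord (A B : Fin N) : pd A (fun y => y B) x = if B = A then 1 else 0 := by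
  have h1 : HasFDerivAt (fun y : Fin N → ℝ => y B)
      (ContinuousLinearMap.proj (R := ℝ) (φ := fun _ : Fin N => ℝ) B) x := hasFDerivAt_apply B x
  simp only [pd, h1.fderiv, ContinuousLinearMap.proj_apply, Pi.single_apply]

lemma pd_comm (hf : SmoothOffZero f) (A B : Fin N) (hx : x ≠ 0) :
    pd A (pd B f) x = pd B (pd A f) x := by
  have hd : DifferentiableAt ℝ (fderiv ℝ f) x :=
    ((hf.contDiffAt hx).fderiv_right (m := 1) (WithTop.coe_le_coe.2 le_top)).differentiableAt
      one_ne_zero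
  have key : ∀ C D : Fin N, pd C (pd D f) x =
      fderiv ℝ (fderiv ℝ f) x (Pi.single C 1) (Pi.single D 1) := by
    intro C D
    change fderiv ℝ (fun y => fderiv ℝ f y (Pi.single D 1)) x (Pi.single C 1) = _
    rw [fderiv_clm_apply hd (differentiableAt_const _)]
    simp
  rw [key, key]
  exact (hf.contDiffAt hx).isSymmSndFDerivAt
    (minSmoothness_of_isRCLikeNormedField.trans_le (WithTop.coe_le_coe.2 le_top)) _ _

lemma lap_add (hInv : Matrix (Fin N) (Fin N) ℝ) (hf : SmoothOffZero f) (hg : SmoothOffZero g)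
    (hx : x ≠ 0) : lap hInv (fun y => f y + g y) x = lap hInv f x + lap hInv g x := by
  simp only [lap, ← Finset.sum_add_distrib, ← mul_add]
  refine Finset.sum_congr rfl fun A _ => Finset.sum_congr rfl fun B _ => ?_
  rw [pd_congr (fun y hy => pd_add hf hg B hy) A hx, pd_add (hf.pd B) (hg.pd B) A hx]

lemma lap_const_mul (hInv : Matrix (Fin N) (Fin N) ℝ) (c : ℝ) (hf : SmoothOffZero f)
    (hx : x ≠ 0) : lap hInv (fun y => c * f y) x = c * lap hInv f x := by
  simp only [lap, Finset.mul_sum]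
  refine Finset.sum_congr rfl fun A _ => Finset.sum_congr rfl fun B _ => ?_
  rw [pd_congr (fun y hy => pd_const_mul c hf B hy) A hx, pd_const_mul c (hf.pd B) A hx]
  ring

lemma iterate_lap_add (hInv : Matrix (Fin N) (Fin N) ℝ) (hf : SmoothOffZero f)
    (hg : SmoothOffZero g) (k : ℕ) : ∀ x, x ≠ 0 →
      (lap hInv)^[k] (fun y => f y + g y) x = (lap hInv)^[k] f x + (lap hInv)^[k] g x := by
  induction k with
  | zero => exact fun _ _ => rfl
  | succ k ih =>
    intro x hx
    simp only [Function.iterate_succ_apply']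
    rw [lap_congr hInv ih hx, lap_add hInv (hf.iterate_lap hInv k) (hg.iterate_lap hInv k) hx]

end PartialDerivatives

section Homogeneity

variable {N : ℕ} {f g : (Fin N → ℝ) → ℝ} {w : ℝ}

lemma Homog.pd (hf : SmoothOffZero f) (hw : Homog w f) (B : Fin N) : Homog (w - 1) (pd B f) := by
  intro x hx
  have h1 := pd_congr hw B hx
  rw [pd_sum (fun A _ => (smoothOffZero_coord A).mul (hf.pd A)) B hx, pd_const_mul w hf B hx] at h1
  simp_rw [fun A => pd_mul (smoothOffZero_coord A) (hf.pd A) B hx, pd_coord,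
    Finset.sum_add_distrib, ite_mul, one_mul, zero_mul] at h1
  rw [Finset.sum_ite_eq' Finset.univ B, if_pos (Finset.mem_univ B)] at h1
  simp_rw [fun A => pd_comm hf A B hx]
  linarith

lemma Homog.const_mul (hf : SmoothOffZero f) (hw : Homog w f) (c : ℝ) :
    Homog w (fun y => c * f y) := by
  intro x hx
  simp_rw [fun A => pd_const_mul c hf A hx, mul_left_comm _ c, ← Finset.mul_sum, hw x hx]

lemma Homog.sum {ι : Type*} {s : Finset ι} {F : ι → (Fin N → ℝ) → ℝ}
    (hF : ∀ i ∈ s, SmoothOffZero (F i)) (hw : ∀ i ∈ s, Homog w (F i)) :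
    Homog w (fun y => ∑ i ∈ s, F i y) := by
  intro x hx
  simp_rw [fun A => pd_sum hF A hx, Finset.mul_sum]
  rw [Finset.sum_comm]
  exact Finset.sum_congr rfl fun i hi => hw i hi x hx

lemma Homog.lap (hf : SmoothOffZero f) (hw : Homog w f) (hInv : Matrix (Fin N) (Fin N) ℝ) :
    Homog (w - 2) (lap hInv f) := by
  have h2 : ∀ A B, Homog (w - 2) (_root_.pd A (_root_.pd B f)) := fun A B => by
    have := Homog.pd (hf.pd B) (Homog.pd hf hw B) A
    rwa [sub_sub, one_add_one_eq_two] at this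
  have hs : ∀ A B, SmoothOffZero (fun y => hInv A B * _root_.pd A (_root_.pd B f) y) :=
    fun A B => ((hf.pd B).pd A).const_mul _
  exact Homog.sum (fun A _ => SmoothOffZero.sum fun B _ => hs A B) fun A _ =>
    Homog.sum (fun B _ => hs A B) fun B _ => Homog.const_mul ((hf.pd B).pd A) (h2 A B) _

lemma Homog.iterate_lap (hf : SmoothOffZero f) (hw : Homog w f)
    (hInv : Matrix (Fin N) (Fin N) ℝ) (k : ℕ) : Homog (w - 2 * k) ((_root_.lap hInv)^[k] f) := by
  induction k with
  | zero => simpa using hw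
  | succ k ih =>
    rw [Function.iterate_succ_apply']
    convert Homog.lap (hf.iterate_lap hInv k) ih hInv using 1
    push_cast
    ring

lemma Homog.sub (hf : SmoothOffZero f) (hg : SmoothOffZero g) (hfw : Homog w f)
    (hgw : Homog w g) : Homog w (fun y => f y - g y) := by
  intro x hx
  have h1 : ∀ A, _root_.pd A (fun y => f y - g y) x = _root_.pd A f x - _root_.pd A g x :=
    fun A => by
      simp only [_root_.pd]
      rw [fderiv_fun_sub (hf.differentiableAt hx) (hg.differentiableAt hx)]
      rfl
  simp_rw [h1, mul_sub, Finset.sum_sub_distrib, hfw x hx, hgw x hx]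

end Homogeneity

section QuadraticForm

variable {N : ℕ} {h hInv : Matrix (Fin N) (Fin N) ℝ} {g : (Fin N → ℝ) → ℝ} {w : ℝ}
  {x : Fin N → ℝ}

lemma smoothOffZero_Xc (A : Fin N) : SmoothOffZero (Xc h A) :=
  SmoothOffZero.sum fun B _ => (smoothOffZero_coord B).const_mul _

lemma smoothOffZero_Qfun : SmoothOffZero (Qfun h) :=
  SmoothOffZero.sum fun A _ => SmoothOffZero.sum fun B _ =>
    ((smoothOffZero_coord A).const_mul _).mul (smoothOffZero_coord B)

lemma Qfun_eq_sum_Xc : Qfun h x = ∑ A, x A * Xc h A x := by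
  simp only [Qfun, Xc, Finset.mul_sum]
  exact Finset.sum_congr rfl fun A _ => Finset.sum_congr rfl fun B _ => by ring

lemma pd_Xc (A B : Fin N) (hx : x ≠ 0) : pd A (Xc h B) x = h B A := by
  change pd A (fun y => ∑ C, h B C * y C) x = _
  rw [pd_sum (fun C _ => (smoothOffZero_coord C).const_mul _) A hx]
  simp_rw [fun C => pd_const_mul (h B C) (smoothOffZero_coord C) A hx, pd_coord]
  simp

lemma pd_Qfun (hSymm : ∀ A B, h A B = h B A) (A : Fin N) (hx : x ≠ 0) :
    pd A (Qfun h) x = 2 * Xc h A x := by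
  rw [pd_congr (fun y _ => Qfun_eq_sum_Xc) A hx,
    pd_sum (fun B _ => (smoothOffZero_coord B).mul (smoothOffZero_Xc B)) A hx]
  simp_rw [fun B => pd_mul (smoothOffZero_coord B) (smoothOffZero_Xc (h := h) B) A hx, pd_coord,
    fun B => pd_Xc (h := h) A B hx, Finset.sum_add_distrib, ite_mul, one_mul, zero_mul]
  rw [Finset.sum_ite_eq' Finset.univ A, if_pos (Finset.mem_univ A), two_mul]
  congr 1
  exact Finset.sum_congr rfl fun B _ => by rw [hSymm B A, mul_comm]

lemma sum_hInv_mul_Xc_right (hInvh : h * hInv = 1) (A : Fin N) :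
    ∑ B, hInv A B * Xc h B x = x A := by
  have h1 : (hInv * h).mulVec x = x := by rw [mul_eq_one_comm.1 hInvh, Matrix.one_mulVec]
  rw [← Matrix.mulVec_mulVec] at h1
  exact congrFun h1 A

lemma sum_hInv_mul_Xc_left (hSymm : ∀ A B, h A B = h B A) (hInvh : h * hInv = 1) (B : Fin N) :
    ∑ A, hInv A B * Xc h A x = x B := by
  have h1 : Matrix.vecMul x (h * hInv) = x := by rw [hInvh, Matrix.vecMul_one]
  rw [← Matrix.vecMul_vecMul] at h1
  refine Eq.trans (Finset.sum_congr rfl fun A _ => ?_) (congrFun h1 B)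
  simp only [Xc, Matrix.vecMul, dotProduct]
  rw [mul_comm]
  congr 1
  exact Finset.sum_congr rfl fun C _ => by rw [hSymm A C, mul_comm]

lemma sum_hInv_mul_h (hInvh : h * hInv = 1) : ∑ A, ∑ B, hInv A B * h B A = N := by
  have h1 : (hInv * h).trace = N := by
    rw [mul_eq_one_comm.1 hInvh, Matrix.trace_one, Fintype.card_fin]
  exact h1

lemma pd_pd_Qfun_mul (hSymm : ∀ A B, h A B = h B A) (hg : SmoothOffZero g) (A B : Fin N)
    (hx : x ≠ 0) : pd A (pd B (fun y => Qfun h y * g y)) x =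
      Qfun h x * pd A (pd B g) x + 2 * Xc h A x * pd B g x
        + 2 * Xc h B x * pd A g x + 2 * h B A * g x := by
  have h1 : ∀ y, y ≠ 0 → pd B (fun y => Qfun h y * g y) y =
      Qfun h y * pd B g y + 2 * (Xc h B y * g y) := fun y hy => by
    rw [pd_mul smoothOffZero_Qfun hg B hy, pd_Qfun hSymm B hy]
    ring
  have hX := smoothOffZero_Xc (h := h) B
  rw [pd_congr h1 A hx, pd_add (smoothOffZero_Qfun.mul (hg.pd B)) ((hX.mul hg).const_mul 2) A hx,
    pd_const_mul 2 (hX.mul hg) A hx, pd_mul smoothOffZero_Qfun (hg.pd B) A hx,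
    pd_mul hX hg A hx, pd_Qfun hSymm A hx, pd_Xc A B hx]
  ring

lemma lap_Qfun_mul (hSymm : ∀ A B, h A B = h B A) (hInvh : h * hInv = 1)
    (hg : SmoothOffZero g) (hw : Homog w g) (hx : x ≠ 0) :
    lap hInv (fun y => Qfun h y * g y) x = Qfun h x * lap hInv g x + (2 * N + 4 * w) * g x := by
  have e1 : ∑ A, ∑ B, hInv A B * (2 * Xc h A x * pd B g x) = 2 * (w * g x) := by
    rw [Finset.sum_comm, ← hw x hx, Finset.mul_sum]
    refine Finset.sum_congr rfl fun B _ => ?_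
    rw [← sum_hInv_mul_Xc_left (x := x) hSymm hInvh B, Finset.sum_mul, Finset.mul_sum]
    exact Finset.sum_congr rfl fun A _ => by ring
  have e2 : ∑ A, ∑ B, hInv A B * (2 * Xc h B x * pd A g x) = 2 * (w * g x) := by
    rw [← hw x hx, Finset.mul_sum]
    refine Finset.sum_congr rfl fun A _ => ?_
    rw [← sum_hInv_mul_Xc_right (x := x) hInvh A, Finset.sum_mul, Finset.mul_sum]
    exact Finset.sum_congr rfl fun B _ => by ring
  have e3 : ∑ A, ∑ B, hInv A B * (2 * h B A * g x) = 2 * N * g x := by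
    rw [← sum_hInv_mul_h hInvh]
    simp only [Finset.mul_sum, Finset.sum_mul]
    exact Finset.sum_congr rfl fun A _ => Finset.sum_congr rfl fun B _ => by ring
  have e0 : ∑ A, ∑ B, hInv A B * (Qfun h x * pd A (pd B g) x) = Qfun h x * lap hInv g x := by
    simp only [lap, Finset.mul_sum]
    exact Finset.sum_congr rfl fun A _ => Finset.sum_congr rfl fun B _ => by ring
  rw [lap]
  simp_rw [fun A B => pd_pd_Qfun_mul hSymm hg A B hx, mul_add, Finset.sum_add_distrib]
  rw [e0, e1, e2, e3]
  ring

lemma iterate_lap_Qfun_mul (hSymm : ∀ A B, h A B = h B A) (hInvh : h * hInv = 1)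
    (hg : SmoothOffZero g) (hw : Homog w g) (k : ℕ) : ∀ x, x ≠ 0 →
      (lap hInv)^[k + 1] (fun y => Qfun h y * g y) x = Qfun h x * (lap hInv)^[k + 1] g x
        + (k + 1) * (2 * N + 4 * w - 4 * k) * (lap hInv)^[k] g x := by
  induction k with
  | zero =>
    intro x hx
    simpa using lap_Qfun_mul hSymm hInvh hg hw hx
  | succ k ih =>
    intro x hx
    have hs := hg.iterate_lap hInv
    rw [Function.iterate_succ_apply', lap_congr hInv ih hx,
      lap_add hInv (smoothOffZero_Qfun.mul (hs _)) ((hs _).const_mul _) hx,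
      lap_const_mul hInv _ (hs _) hx,
      lap_Qfun_mul hSymm hInvh (hs _) (Homog.iterate_lap hg hw hInv (k + 1)) hx,
      ← Function.iterate_succ_apply' (lap hInv), ← Function.iterate_succ_apply' (lap hInv)]
    push_cast
    ring

lemma exists_Xc_ne_zero (hInvh : h * hInv = 1) (hx : x ≠ 0) : ∃ A, Xc h A x ≠ 0 := by
  by_contra! hc
  refine hx (funext fun A => ?_)
  rw [← sum_hInv_mul_Xc_right (x := x) hInvh A]
  simp [hc]

lemma eq_zero_of_Qfun_mul_eq_zero (hSymm : ∀ A B, h A B = h B A) (hInvh : h * hInv = 1)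
    (hg : SmoothOffZero g) (h0 : ∀ y, y ≠ 0 → Qfun h y * g y = 0) (hx : x ≠ 0) : g x = 0 := by
  rcases mul_eq_zero.1 (h0 x hx) with hQ | hgx
  · obtain ⟨A, hA⟩ := exists_Xc_ne_zero hInvh hx
    have h1 : pd A (fun y => Qfun h y * g y) x = 0 := by
      rw [pd_congr (g := fun _ => 0) h0 A hx]
      simp [pd]
    rw [pd_mul smoothOffZero_Qfun hg A hx, pd_Qfun hSymm A hx, hQ] at h1
    simpa [hA] using h1
  · exact hgx

lemma Homog.of_Qfun_mul (hSymm : ∀ A B, h A B = h B A) (hInvh : h * hInv = 1)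
    (hg : SmoothOffZero g) (hw : Homog w (fun y => Qfun h y * g y)) : Homog (w - 2) g := by
  have hs : SmoothOffZero (fun y => ∑ A, y A * _root_.pd A g y - (w - 2) * g y) :=
    (SmoothOffZero.sum fun A _ => (smoothOffZero_coord A).mul (hg.pd A)).sub (hg.const_mul _)
  intro x hx
  refine sub_eq_zero.1 (eq_zero_of_Qfun_mul_eq_zero hSymm hInvh hs (fun y hy => ?_) hx)
  have h1 := hw y hy
  simp_rw [fun A => pd_mul (smoothOffZero_Qfun (h := h)) hg A hy,
    fun A => pd_Qfun hSymm A hy, mul_add, Finset.sum_add_distrib, mul_left_comm _ (Qfun h y),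
    ← Finset.mul_sum] at h1
  have h2 : ∑ A, y A * (2 * Xc h A y * g y) = 2 * (Qfun h y * g y) := by
    rw [Qfun_eq_sum_Xc, Finset.sum_mul, Finset.mul_sum]
    exact Finset.sum_congr rfl fun A _ => by ring
  rw [h2] at h1
  linear_combination h1

lemma Homog.congr {f : (Fin N → ℝ) → ℝ} (hfg : ∀ y, y ≠ 0 → f y = g y) (hf : Homog w f) :
    Homog w g := by
  intro x hx
  simp_rw [← fun A => pd_congr hfg A hx, hf x hx, hfg x hx]

end QuadraticForm

/-- flat-model tangentiality of `Δ^k`: for `g` homogeneous of weight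
`k−2−n/2`, `Δ^k(Q·g) = Q·Δ^k g` on `ℝ^N ∖ {0}`; consequently the restriction of `Δ^k f`
to the null cone depends only on the restriction of `f` (homogeneous of weight `k−n/2`)
to the null cone. -/
theorem laplacian_pow_tangential
    (n : ℕ) (hn : 1 ≤ n)
    (h hInv : Matrix (Fin (n + 2)) (Fin (n + 2)) ℝ)
    (hSymm : ∀ A B, h A B = h B A) (hInvh : h * hInv = 1)
    (k : ℕ) (hk : 1 ≤ k)
    (g : (Fin (n + 2) → ℝ) → ℝ) (hg : SmoothOffZero g)
    (hhomg : Homog ((k : ℝ) - 2 - (n : ℝ) / 2) g) :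
    (∀ x : Fin (n + 2) → ℝ, x ≠ 0 →
        (lap hInv)^[k] (fun y => Qfun h y * g y) x = Qfun h x * (lap hInv)^[k] g x)
    ∧ (∀ f₁ f₂ : (Fin (n + 2) → ℝ) → ℝ,
        SmoothOffZero f₁ → SmoothOffZero f₂ →
        Homog ((k : ℝ) - (n : ℝ) / 2) f₁ → Homog ((k : ℝ) - (n : ℝ) / 2) f₂ →
        BigOQ h 1 (fun y => f₁ y - f₂ y) →
        ∀ x : Fin (n + 2) → ℝ, x ≠ 0 → Qfun h x = 0 →
          (lap hInv)^[k] f₁ x = (lap hInv)^[k] f₂ x) := by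
  have tangential : ∀ g : (Fin (n + 2) → ℝ) → ℝ, SmoothOffZero g →
      Homog ((k : ℝ) - 2 - (n : ℝ) / 2) g → ∀ x : Fin (n + 2) → ℝ, x ≠ 0 →
        (lap hInv)^[k] (fun y => Qfun h y * g y) x = Qfun h x * (lap hInv)^[k] g x := by
    intro g hg hw x hx
    obtain ⟨m, rfl⟩ := Nat.exists_eq_add_of_le' hk
    rw [iterate_lap_Qfun_mul hSymm hInvh hg hw m x hx]
    push_cast
    ring
  refine ⟨tangential g hg hhomg, fun f₁ f₂ hf₁ hf₂ hw₁ hw₂ ⟨u, hu, hfu⟩ x hx hQ => ?_⟩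
  simp only [pow_one] at hfu
  have hwu : Homog ((k : ℝ) - 2 - (n : ℝ) / 2) u := by
    rw [sub_right_comm]
    exact Homog.of_Qfun_mul hSymm hInvh hu (Homog.congr hfu (Homog.sub hf₁ hf₂ hw₁ hw₂))
  have hsum : ∀ y, y ≠ 0 → f₁ y = f₂ y + Qfun h y * u y := fun y hy => by
    rw [← hfu y hy]
    ring
  rw [iterate_lap_congr hInv hsum k x hx,
    iterate_lap_add hInv hf₂ (smoothOffZero_Qfun.mul hu) k x hx, tangential u hu hwu x hx, hQ]
  ring
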